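/- Let k ≥ 4 be an integer and let G be a connected finite simple graph with at least 2 vertices whose maximum degree Δ(G) satisfies k ≥ Δ(G) ≥ 1. Then i_[kR](G) ≥ |V(G)|·(k+1) / (Δ(G)+1). Moreover, if i_[kR](G) = |V(G)|·(k+1) / (Δ(G)+1), then G is independent [k]-Roman, i.e., i_[kR](G) = (k+1)·i(G). -/

import Mathlib

/-!
Basic definitions for `[k]`-Roman domination on (finite) simple graphs.
-/

namespace KRoman

variable {V : Type*}

/-- `|AN(v)|`: the number of active neighbors of `v` under `f`. -/
noncomputable def activeNbrCard (G : SimpleGraph V) (f : V → ℕ) (v : V) : ℕ :=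
  {u | G.Adj v u ∧ 1 ≤ f u}.ncard

/-- `Σ_{u ∈ N[v]} f(u)`: the sum of `f` over the closed neighborhood of `v`. -/
noncomputable def closedNbhdSum (G : SimpleGraph V) (f : V → ℕ) (v : V) : ℕ :=
  f v + ∑ᶠ u ∈ {u | G.Adj v u}, f u

/-- `f` is a `[k]`-Roman dominating function on `G`. -/
def IsKRDF (G : SimpleGraph V) (k : ℕ) (f : V → ℕ) : Prop :=
  (∀ v, f v ≤ k + 1) ∧
  ∀ v, f v < k → k + activeNbrCard G f v ≤ closedNbhdSum G f v

/-- `f` is an independent `[k]`-Roman dominating function on `G`: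
a `[k]`-RDF whose set of active vertices is independent. -/
def IsKIRDF (G : SimpleGraph V) (k : ℕ) (f : V → ℕ) : Prop :=
  IsKRDF G k f ∧ ∀ u v, G.Adj u v → ¬(1 ≤ f u ∧ 1 ≤ f v)

/-- The weight `ω(f) = Σ_v f(v)` of a labeling. -/
noncomputable def weight (f : V → ℕ) : ℕ := ∑ᶠ v, f v

/-- The `[k]`-Roman domination number `γ_[kR](G)`. -/
noncomputable def gammaKR (G : SimpleGraph V) (k : ℕ) : ℕ :=
  sInf {w | ∃ f : V → ℕ, IsKRDF G k f ∧ weight f = w}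

/-- The independent `[k]`-Roman domination number `i_[kR](G)`. -/
noncomputable def iKR (G : SimpleGraph V) (k : ℕ) : ℕ :=
  sInf {w | ∃ f : V → ℕ, IsKIRDF G k f ∧ weight f = w}

/-- The degree of a vertex. -/
noncomputable def deg (G : SimpleGraph V) (v : V) : ℕ := {u | G.Adj v u}.ncard


/-- `S` is an independent dominating set of `G`. -/
def IsIndepDomSet (G : SimpleGraph V) (S : Set V) : Prop :=
  (∀ u ∈ S, ∀ v ∈ S, ¬ G.Adj u v) ∧ ∀ v, v ∉ S → ∃ u ∈ S, G.Adj u v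

/-- The independent domination number `i(G)`. -/
noncomputable def indepDom (G : SimpleGraph V) : ℕ :=
  sInf {n | ∃ S : Set V, IsIndepDomSet G S ∧ S.ncard = n}

/-- The maximum degree `Δ(G)`. -/
noncomputable def maxDeg (G : SimpleGraph V) : ℕ := sSup {d | ∃ v, deg G v = d}

open Classical in
/-- Pointwise inequality at an inactive vertex. -/
theorem KRoman_aux_local {V : Type*} (N : Finset V) (f : V → ℕ) (k : ℕ) (hk : 4 ≤ k)
    (hf : ∀ u ∈ N, f u = 0 ∨ f u = k ∨ f u = k + 1)
    (h : k + (N.filter (fun u => 1 ≤ f u)).card ≤ ∑ u ∈ N, f u) :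
    k + 1 ≤ ∑ u ∈ N, (f u - if f u = k then 1 else 0) ∧
    ((∃ u ∈ N, f u = k) → k + 1 < ∑ u ∈ N, (f u - if f u = k then 1 else 0)) := by
  have key : (∃ u ∈ N, f u = k) →
      k + 1 < ∑ u ∈ N, (f u - if f u = k then 1 else 0) := by
    rintro ⟨w, hw, hwk⟩
    have h2 : ∃ x ∈ N, x ≠ w ∧ 1 ≤ f x := by
      by_contra hcon
      push Not at hcon
      have hs : ∑ u ∈ N, f u = f w := by
        apply Finset.sum_eq_single_of_mem w hw
        intro b hb hbw
        have := hcon b hb hbw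
        omega
      have hc : 1 ≤ (N.filter (fun u => 1 ≤ f u)).card := by
        apply Finset.card_pos.mpr
        exact ⟨w, by simp [hw, hwk]; omega⟩
      omega
    obtain ⟨x, hx, hxw, hx1⟩ := h2
    have hsub : ({x, w} : Finset V) ⊆ N := by
      intro y hy
      simp only [Finset.mem_insert, Finset.mem_singleton] at hy
      rcases hy with rfl | rfl <;> assumption
    have h3 := Finset.sum_le_sum_of_subset (f := fun u => f u - if f u = k then 1 else 0) hsub
    rw [Finset.sum_pair hxw] at h3
    have := hf x hx
    simp only [hwk, if_true] at h3
    split_ifs at h3 <;> omega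
  refine ⟨?_, key⟩
  by_cases hex : ∃ u ∈ N, f u = k
  · exact (key hex).le
  · push Not at hex
    have h2 : ∃ x ∈ N, f x ≠ 0 := by
      by_contra hcon
      push Not at hcon
      rw [Finset.sum_eq_zero hcon] at h
      omega
    obtain ⟨x, hx, hx0⟩ := h2
    have h3 := Finset.single_le_sum (f := fun u => f u - if f u = k then 1 else 0)
      (fun _ _ => Nat.zero_le _) hx
    have h4 := hf x hx
    have h5 := hex x hx
    simp only [h5, if_false] at h3
    omega

open Classical in
theorem KRoman_aux_core {V : Type*} [Fintype V] (G : SimpleGraph V) (k : ℕ)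
    (hk : 4 ≤ k) (hdeg1 : ∀ v, ∃ w, G.Adj v w) (f : V → ℕ) (hf : IsKIRDF G k f) :
    (Fintype.card V * (k + 1) ≤ (maxDeg G + 1) * ∑ v, f v) ∧
    (Fintype.card V * (k + 1) = (maxDeg G + 1) * ∑ v, f v → ∀ v, f v = 0 ∨ f v = k + 1) := by
  obtain ⟨⟨hle, hdom⟩, hind⟩ := hf
  have hsum : ∀ v, closedNbhdSum G f v = f v + ∑ u ∈ G.neighborFinset v, f u := by
    intro v
    unfold closedNbhdSum
    congr 1
    rw [← finsum_mem_coe_finset]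
    simp [SimpleGraph.neighborSet]
  have hact : ∀ v, activeNbrCard G f v =
      ((G.neighborFinset v).filter (fun u => 1 ≤ f u)).card := by
    intro v
    unfold activeNbrCard
    rw [← Set.ncard_coe_finset]
    congr 1
    ext u
    simp
  have hd : ∀ v, G.degree v ≤ maxDeg G := by
    intro v
    have : deg G v = G.degree v := by
      unfold deg
      rw [← SimpleGraph.card_neighborFinset_eq_degree, ← Set.ncard_coe_finset]
      congr 1
      ext u
      simp
    rw [← this]
    unfold maxDeg
    apply le_csSup
    · exact (Set.finite_range (deg G)).bddAbove
    · exact ⟨v, rfl⟩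
  have hval : ∀ v, f v = 0 ∨ f v = k ∨ f v = k + 1 := by
    intro v
    by_contra hcon
    push Not at hcon
    have h1 := hle v
    have h2 := hdom v (by omega)
    rw [hsum] at h2
    have h3 : ∑ u ∈ G.neighborFinset v, f u = 0 := by
      apply Finset.sum_eq_zero
      intro u hu
      have := hind v u (by simpa using hu)
      omega
    omega
  set g : V → ℕ := fun u => if f u = k then 1 else 0 with hg
  set P : V → ℕ := fun v => f v + g v + ∑ u ∈ G.neighborFinset v, (f u - g u) with hP
  have hloc : ∀ v, f v = 0 → k + 1 ≤ ∑ u ∈ G.neighborFinset v, (f u - g u) ∧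
    ((∃ u ∈ G.neighborFinset v, f u = k) →
      k + 1 < ∑ u ∈ G.neighborFinset v, (f u - g u)) := by
    intro v hv
    apply KRoman_aux_local _ f k hk (fun u _ => hval u)
    have := hdom v (by omega)
    rw [hsum, hact] at this
    omega
  have hPle : ∀ v, k + 1 ≤ P v := by
    intro v
    simp only [hP]
    rcases hval v with h | h | h
    · have := (hloc v h).1
      omega
    · have : g v = 1 := by simp [hg, h]
      omega
    · omega
  have hdc : ∑ v, ∑ u ∈ G.neighborFinset v, (f u - g u) = ∑ u, G.degree u * (f u - g u) := by
    rw [Finset.sum_comm' (t' := Finset.univ) (s' := fun u => G.neighborFinset u)]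
    · simp
    · intro x y
      simp [G.adj_comm]
  have hup : ∑ v, P v ≤ (maxDeg G + 1) * ∑ v, f v := by
    simp only [hP]
    rw [Finset.sum_add_distrib, hdc, ← Finset.sum_add_distrib, Finset.mul_sum]
    apply Finset.sum_le_sum
    intro v _
    have h1 : 1 ≤ G.degree v := by
      rw [Nat.succ_le_iff, SimpleGraph.degree_pos_iff_exists_adj]
      exact hdeg1 v
    have h2 := hd v
    have h3 : g v ≤ f v := by
      simp only [hg]; split_ifs <;> omega
    obtain ⟨c, hc⟩ := Nat.exists_eq_add_of_le h3
    rw [hc]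
    simp only [Nat.add_sub_cancel_left]
    nlinarith [Nat.mul_le_mul_right c h2, Nat.mul_le_mul_right (g v) (h1.trans h2)]
  have hlow : Fintype.card V * (k + 1) = ∑ v : V, (k + 1) := by simp
  refine ⟨?_, ?_⟩
  · rw [hlow]
    exact (Finset.sum_le_sum fun v _ => hPle v).trans hup
  · intro heq v
    rcases hval v with h | h | h
    · exact Or.inl h
    · exfalso
      obtain ⟨w, hw⟩ := hdeg1 v
      have hw0 : f w = 0 := by
        have := hind v w hw
        omega
      have h1 := (hloc w hw0).2 ⟨v, by simpa using hw.symm, h⟩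
      have h2 : ∑ v : V, (k + 1) < ∑ v, P v := by
        apply Finset.sum_lt_sum (fun v _ => hPle v)
        exact ⟨w, Finset.mem_univ _, by simp only [hP]; omega⟩
      omega
    · exact Or.inr h

open Classical in
/-- An independent dominating set gives a `[k]`-IRDF of weight `(k+1)|S|`. -/
theorem KRoman_aux_ofSet {V : Type*} [Fintype V] (G : SimpleGraph V) (k : ℕ)
    (S : Set V) (hS : IsIndepDomSet G S) :
    ∃ f : V → ℕ, IsKIRDF G k f ∧ weight f = (k + 1) * S.ncard := by
  obtain ⟨hi, hdm⟩ := hS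
  refine ⟨fun v => if v ∈ S then k + 1 else 0, ⟨⟨?_, ?_⟩, ?_⟩, ?_⟩
  · intro v
    dsimp only
    split_ifs <;> omega
  · intro v hv
    have hvS : v ∉ S := by
      intro h
      simp [h] at hv
    unfold activeNbrCard closedNbhdSum
    set T : Finset V := Finset.univ.filter (fun u => G.Adj v u ∧ u ∈ S) with hT
    have h1 : {u | G.Adj v u ∧ 1 ≤ (if u ∈ S then k + 1 else 0)}.ncard = T.card := by
      rw [← Set.ncard_coe_finset]
      congr 1
      ext u
      by_cases h : u ∈ S <;> simp [hT, h]
    have h2 : ∑ᶠ u ∈ {u | G.Adj v u}, (if u ∈ S then k + 1 else 0) = T.card * (k + 1) := by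
      have : {u | G.Adj v u} = ((Finset.univ.filter (fun u => G.Adj v u) : Finset V) : Set V) := by
        ext u; simp
      rw [this, finsum_mem_coe_finset, ← Finset.sum_filter, Finset.filter_filter]
      simp [hT]
    rw [h1, h2]
    have h3 : 1 ≤ T.card := by
      obtain ⟨u, hu, hadj⟩ := hdm v hvS
      exact Finset.card_pos.mpr ⟨u, by simp [hT, hu, hadj.symm]⟩
    have h4 := Nat.mul_le_mul_right k h3
    rw [Nat.mul_succ]
    omega
  · rintro u v hadj ⟨h1, h2⟩
    have hu : u ∈ S := by
      by_contra h
      simp [h] at h1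
    have hv : v ∈ S := by
      by_contra h
      simp [h] at h2
    exact hi u hu v hv hadj
  · unfold weight
    rw [finsum_eq_sum_of_fintype, ← Finset.sum_filter]
    have : S.ncard = (Finset.univ.filter (fun u => u ∈ S)).card := by
      rw [← Set.ncard_coe_finset]
      congr 1
      ext u
      simp
    rw [this]
    simp [mul_comm]

theorem KRoman_aux_exists {V : Type*} [Finite V] (G : SimpleGraph V) :
    ∃ S : Set V, IsIndepDomSet G S := by
  obtain ⟨S, hS⟩ := (Set.toFinite {S : Set V | ∀ u ∈ S, ∀ v ∈ S, ¬ G.Adj u v}).exists_maximal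
    ⟨∅, by simp⟩
  refine ⟨S, hS.prop, ?_⟩
  intro v hv
  by_contra hcon
  push Not at hcon
  apply hv
  have := hS.le_of_ge (y := insert v S) ?_ (Set.subset_insert v S)
  · exact this (Set.mem_insert v S)
  · intro a ha b hb
    rcases ha with rfl | ha <;> rcases hb with rfl | hb
    · exact G.loopless.irrefl _
    · exact fun h => hcon b hb h.symm
    · exact hcon a ha
    · exact hS.prop a ha b hb

/-- For `k ≥ 4` and a nontrivial connected graph `G` with
`k ≥ Δ(G) ≥ 1`, one has `i_[kR](G) ≥ |V(G)|·(k+1)/(Δ(G)+1)`; moreover, if equality holds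
then `G` is independent `[k]`-Roman, i.e. `i_[kR](G) = (k+1)·i(G)`. -/
theorem iKR_lower_bound_of_maxDeg_le {V : Type*} [Finite V] (G : SimpleGraph V) (k : ℕ)
    (hk : 4 ≤ k) (hconn : G.Connected) (hcard : 2 ≤ Nat.card V)
    (hΔ1 : 1 ≤ maxDeg G) (hΔk : maxDeg G ≤ k) :
    ((Nat.card V : ℝ) * (k + 1)) / ((maxDeg G : ℝ) + 1) ≤ (iKR G k : ℝ) ∧
    ((iKR G k : ℝ) = ((Nat.card V : ℝ) * (k + 1)) / ((maxDeg G : ℝ) + 1) →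
      iKR G k = (k + 1) * indepDom G) := by
  classical
  haveI := Fintype.ofFinite V
  haveI : Nontrivial V := Finite.one_lt_card_iff_nontrivial.mp hcard
  have hdeg1 : ∀ v, ∃ w, G.Adj v w := fun v => hconn.preconnected.exists_adj_of_nontrivial v
  have hiKR : iKR G k ∈ {w | ∃ f : V → ℕ, IsKIRDF G k f ∧ weight f = w} := by
    apply Nat.sInf_mem
    obtain ⟨S, hS⟩ := KRoman_aux_exists G
    obtain ⟨f, hf, hw⟩ := KRoman_aux_ofSet G k S hS
    exact ⟨_, f, hf, hw⟩
  have hID : indepDom G ∈ {n | ∃ S : Set V, IsIndepDomSet G S ∧ S.ncard = n} := by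
    apply Nat.sInf_mem
    obtain ⟨S, hS⟩ := KRoman_aux_exists G
    exact ⟨_, S, hS, rfl⟩
  obtain ⟨f, hf, hw⟩ := hiKR
  have hw' := hw
  unfold weight at hw'
  rw [finsum_eq_sum_of_fintype] at hw'
  have hcore := KRoman_aux_core G k hk hdeg1 f hf
  rw [hw', ← Nat.card_eq_fintype_card] at hcore
  obtain ⟨hc1, hc2⟩ := hcore
  have hpos : (0 : ℝ) < (maxDeg G : ℝ) + 1 := by positivity
  refine ⟨?_, ?_⟩
  · rw [div_le_iff₀ hpos, mul_comm (iKR G k : ℝ)]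
    exact_mod_cast hc1
  · intro heq
    rw [eq_div_iff hpos.ne', mul_comm (iKR G k : ℝ)] at heq
    have hv := hc2 (by exact_mod_cast heq.symm)
    apply le_antisymm
    · obtain ⟨S, hS, hn⟩ := hID
      obtain ⟨f', hf', hw2⟩ := KRoman_aux_ofSet G k S hS
      rw [← hn]
      exact Nat.sInf_le ⟨f', hf', hw2⟩
    · have hdomS : IsIndepDomSet G {v | f v = k + 1} := by
        refine ⟨?_, ?_⟩
        · intro u hu v hv' hadj
          simp only [Set.mem_setOf_eq] at hu hv'
          exact hf.2 u v hadj ⟨by omega, by omega⟩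
        · intro v hvn
          by_contra hcon
          push Not at hcon
          have h0 : f v = 0 := (hv v).resolve_right hvn
          have h1 := hf.1.2 v (by omega)
          have h2 : closedNbhdSum G f v = 0 := by
            unfold closedNbhdSum
            rw [h0, zero_add]
            apply finsum_mem_eq_zero_of_forall_eq_zero
            intro u hu
            exact (hv u).resolve_right (fun h => hcon u h hu.symm)
          omega
      have hle : indepDom G ≤ {v | f v = k + 1}.ncard := Nat.sInf_le ⟨_, hdomS, rfl⟩
      have hwt : iKR G k = (k + 1) * {v | f v = k + 1}.ncard := by
        have : {v | f v = k + 1}.ncard = (Finset.univ.filter (fun u => f u = k + 1)).card := by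
          rw [← Set.ncard_coe_finset]
          congr 1
          ext u
          simp
        rw [← hw', this, mul_comm, ← smul_eq_mul, ← Finset.sum_const, Finset.sum_filter]
        apply Finset.sum_congr rfl
        intro v _
        rcases hv v with h | h <;> simp [h]
      rw [hwt]
      exact Nat.mul_le_mul_left _ hle
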